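/- Let F_1, …, F_m be Borel probability distributions on ℝ_{≥0} with finite mean and let μ be their product distribution on ℝ_{≥0}^m (a single unit-demand buyer with independent item values). Then the optimal item-pricing revenue under μ is at least one fourth of the optimal lottery revenue under μ. -/

import Mathlib

open MeasureTheory

/-- A lottery over `m` items: allocation probabilities `q` with `q j ≥ 0`,
`∑ j, q j ≤ 1`, and a price `p ≥ 0`. -/
structure Lottery (m : ℕ) where
  q : Fin m → ℝ
  p : ℝ
  q_nonneg : ∀ j, 0 ≤ q j
  q_sum_le_one : ∑ j, q j ≤ 1
  p_nonneg : 0 ≤ p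

/-- The (expected) utility of lottery `ℓ` at valuation `v`. -/
def Lottery.util {m : ℕ} (ℓ : Lottery m) (v : Fin m → ℝ) : ℝ :=
  (∑ j, ℓ.q j * v j) - ℓ.p

/-- The probability vector of a possibly-absent lottery (`⊥` ↦ 0). -/
def selQ {m : ℕ} : Option (Lottery m) → Fin m → ℝ
  | some ℓ => ℓ.q
  | none => 0

/-- The price of a possibly-absent lottery (`⊥` ↦ 0). -/
def selP {m : ℕ} : Option (Lottery m) → ℝ
  | some ℓ => ℓ.p
  | none => 0

/-- `s` is a utility-maximizing selection for the lottery menu `L`. -/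
structure IsSelection {m : ℕ} (L : Set (Lottery m))
    (s : (Fin m → ℝ) → Option (Lottery m)) : Prop where
  measQ : ∀ j, Measurable fun v => selQ (s v) j
  measP : Measurable fun v => selP (s v)
  buy_opt : ∀ v : Fin m → ℝ, (∀ j, 0 ≤ v j) → ∀ ℓ : Lottery m, s v = some ℓ →
    ℓ ∈ L ∧ 0 ≤ ℓ.util v ∧ ∀ ℓ' ∈ L, ℓ'.util v ≤ ℓ.util v
  no_buy : ∀ v : Fin m → ℝ, (∀ j, 0 ≤ v j) → s v = none →
    ∀ ℓ ∈ L, ℓ.util v ≤ 0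

/-- Expected revenue of a selection under the valuation distribution `μ`. -/
noncomputable def lotteryRevenue {m : ℕ} (μ : Measure (Fin m → ℝ))
    (s : (Fin m → ℝ) → Option (Lottery m)) : ℝ :=
  ∫ v, selP (s v) ∂μ

/-- An item pricing: every lottery in the menu allocates some item
deterministically (its probability vector is a standard basis vector). -/
def IsItemPricing {m : ℕ} (L : Set (Lottery m)) : Prop :=
  ∀ ℓ ∈ L, ∃ j : Fin m, ℓ.q = fun j' => if j' = j then 1 else 0

/-- The optimal item-pricing revenue under `μ`. -/
noncomputable def optItemPricingRev {m : ℕ} (μ : Measure (Fin m → ℝ)) : ℝ :=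
  sSup {r : ℝ | ∃ (L : Set (Lottery m)) (s : (Fin m → ℝ) → Option (Lottery m)),
    L.Nonempty ∧ IsItemPricing L ∧ IsSelection L s ∧ r = lotteryRevenue μ s}

/-- The optimal lottery revenue under `μ`. -/
noncomputable def optLotteryRev {m : ℕ} (μ : Measure (Fin m → ℝ)) : ℝ :=
  sSup {r : ℝ | ∃ (L : Set (Lottery m)) (s : (Fin m → ℝ) → Option (Lottery m)),
    L.Nonempty ∧ IsSelection L s ∧ r = lotteryRevenue μ s}

/-- A dominant-strategy incentive compatible, individually rational
deterministic single-item auction for `m` bidders: `x v = some j` means bidder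
`j` wins, `x v = none` means no winner; `pay v j ≥ 0` is bidder `j`'s payment. -/
structure IsAuction {m : ℕ} (x : (Fin m → ℝ) → Option (Fin m))
    (pay : (Fin m → ℝ) → Fin m → ℝ) : Prop where
  measX : ∀ j : Fin m, MeasurableSet {v | x v = some j}
  measPay : ∀ j : Fin m, Measurable fun v => pay v j
  pay_nonneg : ∀ v j, 0 ≤ pay v j
  ic : ∀ v : Fin m → ℝ, (∀ j, 0 ≤ v j) → ∀ (j : Fin m) (v' : ℝ), 0 ≤ v' →
    (if x (Function.update v j v') = some j then v j else 0)
        - pay (Function.update v j v') j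
      ≤ (if x v = some j then v j else 0) - pay v j
  ir : ∀ v : Fin m → ℝ, (∀ j, 0 ≤ v j) → ∀ j : Fin m,
    0 ≤ (if x v = some j then v j else 0) - pay v j

/-- Expected revenue of a single-item auction under `μ`. -/
noncomputable def auctionRevenue {m : ℕ} (μ : Measure (Fin m → ℝ))
    (pay : (Fin m → ℝ) → Fin m → ℝ) : ℝ :=
  ∫ v, ∑ j, pay v j ∂μ

section

open Set

/-- The largest expected surplus over `t` from a posted price for a value drawn from `ν`. -/
noncomputable def postedSurplus (ν : Measure ℝ) (t : ℝ) : ℝ :=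
  ⨆ p : ℝ, (p - t) * ν.real (Ici p)

section postedSurplus

variable {ν : Measure ℝ} [IsProbabilityMeasure ν]

theorem bddAbove_postedSurplus (h₀ : ν (Iio 0) = 0) (hν : Integrable id ν) (t : ℝ) :
    BddAbove (range fun p : ℝ => (p - t) * ν.real (Ici p)) := by
  refine ⟨∫ x, x ∂ν + |t|, ?_⟩
  rintro _ ⟨p, rfl⟩
  have hpos : 0 ≤ᵐ[ν] (id : ℝ → ℝ) := by
    refine measure_mono_null (fun x hx => ?_) h₀
    simpa using hx
  have hmarkov := mul_meas_ge_le_integral_of_nonneg hpos hν p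
  have hle : ν.real (Ici p) ≤ 1 := measureReal_le_one
  have hnn : 0 ≤ ν.real (Ici p) := measureReal_nonneg
  have hset : {x : ℝ | p ≤ id x} = Ici p := rfl
  rw [hset] at hmarkov
  simp only [id] at hmarkov ⊢
  nlinarith [neg_abs_le t, abs_nonneg t, le_abs_self t]

theorem le_postedSurplus (h₀ : ν (Iio 0) = 0) (hν : Integrable id ν) (t p : ℝ) :
    (p - t) * ν.real (Ici p) ≤ postedSurplus ν t :=
  le_ciSup (bddAbove_postedSurplus h₀ hν t) p

theorem postedSurplus_nonneg (h₀ : ν (Iio 0) = 0) (hν : Integrable id ν) (t : ℝ) :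
    0 ≤ postedSurplus ν t := by
  simpa using le_postedSurplus h₀ hν t t

theorem continuous_postedSurplus (h₀ : ν (Iio 0) = 0) (hν : Integrable id ν) :
    Continuous (postedSurplus ν) := by
  refine (LipschitzWith.of_le_add fun t t' => ciSup_le fun p => ?_).continuous
  have h := le_postedSurplus h₀ hν t' p
  have hle : ν.real (Ici p) ≤ 1 := measureReal_le_one
  have hnn : 0 ≤ ν.real (Ici p) := measureReal_nonneg
  change _ ≤ postedSurplus ν t' + dist t t'
  rw [Real.dist_eq]
  nlinarith [neg_abs_le (t - t'), abs_nonneg (t - t')]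

theorem postedSurplus_antitone (h₀ : ν (Iio 0) = 0) (hν : Integrable id ν) :
    Antitone (postedSurplus ν) := fun t t' htt' => ciSup_le fun p =>
  (mul_le_mul_of_nonneg_right (by linarith) measureReal_nonneg).trans
    (le_postedSurplus h₀ hν t p)

end postedSurplus

theorem exists_price_ge_postedSurplus_sub_le (ν : Measure ℝ) (t : ℝ) {ε : ℝ} (hε : 0 < ε) :
    ∃ p, t ≤ p ∧ postedSurplus ν t - ε ≤ (p - t) * ν.real (Ici p) := by
  obtain ⟨p, hp⟩ := exists_lt_of_lt_ciSup (sub_lt_self (postedSurplus ν t) hε)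
  rcases le_total t p with h | h
  · exact ⟨p, h, hp.le⟩
  · refine ⟨t, le_rfl, ?_⟩
    have hnn : 0 ≤ ν.real (Ici p) := measureReal_nonneg
    nlinarith

theorem exists_sum_postedSurplus_eq {ι : Type*} [Fintype ι] (F : ι → Measure ℝ)
    [∀ j, IsProbabilityMeasure (F j)] (h₀ : ∀ j, F j (Iio 0) = 0)
    (hF : ∀ j, Integrable id (F j)) :
    ∃ t, 0 ≤ t ∧ ∑ j, postedSurplus (F j) t = t := by
  set S : ℝ → ℝ := fun t => ∑ j, postedSurplus (F j) t
  have hS : Continuous S := continuous_finsetSum _ fun j _ => continuous_postedSurplus (h₀ j) (hF j)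
  have hS₀ : 0 ≤ S 0 := Finset.sum_nonneg fun j _ => postedSurplus_nonneg (h₀ j) (hF j) 0
  have hanti : S (S 0) ≤ S 0 :=
    Finset.sum_le_sum fun j _ => postedSurplus_antitone (h₀ j) (hF j) hS₀
  obtain ⟨t, ht, hteq⟩ := intermediate_value_Icc' hS₀
    (f := fun t => S t - t) (hS.sub continuous_id).continuousOn
    (show (0 : ℝ) ∈ Icc _ _ from ⟨by linarith, by linarith⟩)
  exact ⟨t, ht.1, by simpa [sub_eq_zero] using hteq⟩

/-- A subgradient of `u` integrates to at most the increment of `u`. -/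
theorem integral_subgradient_le {q u : ℝ → ℝ} {a x : ℝ} (hax : a ≤ x)
    (hsub : ∀ y ∈ Icc a x, ∀ z ∈ Icc a x, q y * (z - y) ≤ u z - u y)
    (hq : MonotoneOn q (Icc a x)) :
    ∫ y in a..x, q y ≤ u x - u a := by
  have key : ∀ N : ℕ, 0 < N →
      ∫ y in a..x, q y ≤ u x - u a + (q x - q a) * (x - a) / N := by
    intro N hN
    have hN' : (0 : ℝ) < N := by exact_mod_cast hN
    set δ := (x - a) / N with hδ
    have hδ₀ : 0 ≤ δ := div_nonneg (by linarith) hN'.le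
    set y : ℕ → ℝ := fun i => a + i * δ with hy
    have hstep : ∀ i, y i ≤ y (i + 1) := fun i => by simp only [hy]; push_cast; nlinarith
    have hy0 : y 0 = a := by simp [hy]
    have hyN : y N = x := by simp only [hy, hδ]; field_simp; ring
    have hmono : Monotone y := monotone_nat_of_le_succ hstep
    have hmem : ∀ i ≤ N, y i ∈ Icc a x := fun i hi =>
      ⟨hy0 ▸ hmono (Nat.zero_le i), hyN ▸ hmono hi⟩
    have hint : ∀ i < N, IntervalIntegrable q volume (y i) (y (i + 1)) := fun i hi => by
      refine MonotoneOn.intervalIntegrable (hq.mono ?_)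
      rw [uIcc_of_le (hstep i)]
      exact Icc_subset_Icc (hmem i hi.le).1 (hmem (i + 1) hi).2
    have hpiece : ∀ i ∈ Finset.range N, ∫ z in y i..y (i + 1), q z ≤
        (u (y (i + 1)) - u (y i)) + δ * (q (y (i + 1)) - q (y i)) := by
      intro i hi
      have hi' := Finset.mem_range.1 hi
      have h1 : ∫ z in y i..y (i + 1), q z ≤ ∫ z in y i..y (i + 1), q (y (i + 1)) := by
        refine intervalIntegral.integral_mono_on (hstep i) (hint i hi') (by simp) fun z hz => ?_
        exact hq ⟨(hmem i hi'.le).1.trans hz.1, hz.2.trans (hmem (i + 1) hi').2⟩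
          (hmem (i + 1) hi') hz.2
      have h2 := hsub _ (hmem i hi'.le) _ (hmem (i + 1) hi')
      have h3 : y (i + 1) - y i = δ := by simp only [hy]; push_cast; ring
      rw [intervalIntegral.integral_const, smul_eq_mul, h3] at h1
      rw [h3] at h2
      linarith
    have hsum := Finset.sum_le_sum hpiece
    rw [intervalIntegral.sum_integral_adjacent_intervals hint, Finset.sum_add_distrib,
      ← Finset.mul_sum, Finset.sum_range_sub (fun i => u (y i)),
      Finset.sum_range_sub (fun i => q (y i)), hy0, hyN] at hsum
    calc _ ≤ _ := hsum
      _ = _ := by rw [hδ]; ring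
  have hlim : Filter.Tendsto (fun N : ℕ => u x - u a + (q x - q a) * (x - a) / N)
      Filter.atTop (nhds (u x - u a + 0)) :=
    tendsto_const_nhds.add (tendsto_const_div_atTop_nhds_zero_nat _)
  rw [add_zero] at hlim
  exact ge_of_tendsto hlim (Filter.eventually_atTop.2 ⟨1, fun N hN => key N hN⟩)

theorem monotoneOn_of_subgradient {q u : ℝ → ℝ} {s : Set ℝ}
    (hsub : ∀ y ∈ s, ∀ z ∈ s, q y * (z - y) ≤ u z - u y) : MonotoneOn q s := by
  intro y hy z hz hyz
  rcases hyz.eq_or_lt with rfl | hlt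
  · rfl
  · have h1 := hsub y hy z hz
    have h2 := hsub z hz y hy
    by_contra! hc
    nlinarith

/-- The least surplus over `t` of a value at least `a` at which `q` exceeds `r`. -/
noncomputable def thresholdSurplus (q : ℝ → ℝ) (a t r : ℝ) : ENNReal :=
  ⨅ y, ⨅ (_ : a ≤ y ∧ r < q y), ENNReal.ofReal (y - t)

theorem thresholdSurplus_mono (q : ℝ → ℝ) (a t : ℝ) : Monotone (thresholdSurplus q a t) :=
  fun _ _ hrr' => le_iInf₂ fun y hy => iInf₂_le y ⟨hy.1, hrr'.trans_lt hy.2⟩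

theorem thresholdSurplus_mul_measure_le {ν : Measure ℝ} [IsFiniteMeasure ν] {t a W : ℝ}
    (hta : t ≤ a) (hW : ∀ p, (p - t) * ν.real (Ici p) ≤ W) (q : ℝ → ℝ) (r : ℝ) :
    thresholdSurplus q a t r * ν {x | a ≤ x ∧ r < q x} ≤ ENNReal.ofReal W := by
  rcases eq_empty_or_nonempty {x | a ≤ x ∧ r < q x} with he | ⟨z, hz⟩
  · simp [he]
  have hfin : thresholdSurplus q a t r ≠ ⊤ :=
    ((iInf₂_le z hz).trans_lt ENNReal.ofReal_lt_top).ne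
  set c := (thresholdSurplus q a t r).toReal
  have hc : thresholdSurplus q a t r = ENNReal.ofReal c := (ENNReal.ofReal_toReal hfin).symm
  have hsub : {x | a ≤ x ∧ r < q x} ⊆ Ici (t + c) := by
    intro x hx
    have h : thresholdSurplus q a t r ≤ ENNReal.ofReal (x - t) := iInf₂_le x hx
    rw [hc, ENNReal.ofReal_le_ofReal_iff (by linarith [hx.1])] at h
    exact mem_Ici.2 (by linarith)
  calc thresholdSurplus q a t r * ν {x | a ≤ x ∧ r < q x}
      ≤ ENNReal.ofReal c * ν (Ici (t + c)) := by rw [hc]; gcongr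
    _ = ENNReal.ofReal (c * ν.real (Ici (t + c))) := by
        rw [ENNReal.ofReal_mul ENNReal.toReal_nonneg, ofReal_measureReal]
    _ ≤ ENNReal.ofReal W := ENNReal.ofReal_le_ofReal (by simpa using hW (t + c))

theorem ofReal_surplus_le_lintegral_thresholdSurplus {q u : ℝ → ℝ} {a t x : ℝ} (hta : t ≤ a)
    (hax : a ≤ x) (hqm : Measurable q) (hq₀ : ∀ y, a ≤ y → 0 ≤ q y)
    (hsub : ∀ y ∈ Ici a, ∀ z ∈ Ici a, q y * (z - y) ≤ u z - u y) :
    ENNReal.ofReal ((x - t) * q x - (u x - u a)) ≤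
      ∫⁻ r in Ico 0 (q x), thresholdSurplus q a t r := by
  have hmono := monotoneOn_of_subgradient hsub
  have hmono' : MonotoneOn q (Icc a x) := hmono.mono Icc_subset_Ici_self
  have hint := integral_subgradient_le hax
    (fun y hy z hz => hsub y hy.1 z hz.1) hmono'
  have hqi : IntervalIntegrable q volume a x := by
    refine MonotoneOn.intervalIntegrable ?_
    rwa [uIcc_of_le hax]
  have hgap : ∫ y in a..x, (q x - q y) = (x - a) * q x - ∫ y in a..x, q y := by
    rw [intervalIntegral.integral_sub (by simp) hqi, intervalIntegral.integral_const, smul_eq_mul]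
  have hgap_int : IntegrableOn (fun y => q x - q y) (Ioc a x) := by
    rw [← intervalIntegrable_iff_integrableOn_Ioc_of_le hax]
    exact intervalIntegrable_const.sub hqi
  have hgap_nonneg : 0 ≤ᵐ[volume.restrict (Ioc a x)] fun y => q x - q y := by
    refine (ae_restrict_iff' measurableSet_Ioc).2 (ae_of_all _ fun y hy => ?_)
    exact sub_nonneg.2 (hmono' ⟨hy.1.le, hy.2⟩ ⟨hax, le_rfl⟩ hy.2)
  have hθ : ∀ r, ENNReal.ofReal (a - t) + ∫⁻ y in Ioc a x, {y | q y ≤ r}.indicator 1 y ≤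
      thresholdSurplus q a t r := by
    intro r
    rw [lintegral_indicator_one (measurableSet_le hqm measurable_const),
      Measure.restrict_apply (measurableSet_le hqm measurable_const)]
    refine le_iInf₂ fun z hz => ?_
    have hss : {y | q y ≤ r} ∩ Ioc a x ⊆ Ioo a z := by
      rintro y ⟨hy, hy'⟩
      refine ⟨hy'.1, lt_of_not_ge fun hzy => ?_⟩
      exact absurd (hz.2.trans_le (hmono hz.1 hy'.1.le hzy)) (not_lt.2 hy)
    calc _ ≤ ENNReal.ofReal (a - t) + volume (Ioo a z) := by gcongr
      _ = ENNReal.ofReal (z - t) := by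
        rw [Real.volume_Ioo, ← ENNReal.ofReal_add (by linarith) (by linarith [hz.1])]
        congr 1; ring
  have hmeas : Measurable (Function.uncurry fun (r y : ℝ) =>
      {y | q y ≤ r}.indicator (1 : ℝ → ENNReal) y) := by
    have : (Function.uncurry fun (r y : ℝ) => {y | q y ≤ r}.indicator (1 : ℝ → ENNReal) y) =
        {z : ℝ × ℝ | q z.2 ≤ z.1}.indicator 1 := by
      ext ⟨r, y⟩; simp [indicator]
    rw [this]
    exact measurable_one.indicator (measurableSet_le (hqm.comp measurable_snd) measurable_fst)
  calc ENNReal.ofReal ((x - t) * q x - (u x - u a))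
      ≤ ENNReal.ofReal ((a - t) * q x + ∫ y in a..x, (q x - q y)) :=
        ENNReal.ofReal_le_ofReal (by rw [hgap]; linarith)
    _ = ENNReal.ofReal (a - t) * ENNReal.ofReal (q x) +
        ∫⁻ y in Ioc a x, ENNReal.ofReal (q x - q y) := by
        rw [ENNReal.ofReal_add (mul_nonneg (by linarith) (hq₀ x hax))
          (intervalIntegral.integral_nonneg hax fun y hy =>
            sub_nonneg.2 (hmono' hy ⟨hax, le_rfl⟩ hy.2)),
          ENNReal.ofReal_mul (by linarith), intervalIntegral.integral_of_le hax,
          ofReal_integral_eq_lintegral_ofReal hgap_int hgap_nonneg]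
    _ = ENNReal.ofReal (a - t) * ENNReal.ofReal (q x) +
        ∫⁻ y in Ioc a x, ∫⁻ r in Ico 0 (q x), {y | q y ≤ r}.indicator 1 y := by
        congr 1
        refine setLIntegral_congr_fun measurableSet_Ioc fun y hy => ?_
        have h1 : ∀ r, {y | q y ≤ r}.indicator (1 : ℝ → ENNReal) y =
            (Ici (q y)).indicator 1 r := fun r => by simp [indicator]
        simp only [h1]
        rw [lintegral_indicator_one measurableSet_Ici, Measure.restrict_apply measurableSet_Ici,
          inter_comm, Ico_inter_Ici, Real.volume_Ico, sup_eq_right.2 (hq₀ y hy.1.le)]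
    _ = ∫⁻ r in Ico 0 (q x), (ENNReal.ofReal (a - t) +
          ∫⁻ y in Ioc a x, {y | q y ≤ r}.indicator 1 y) := by
        rw [lintegral_add_left measurable_const, lintegral_lintegral_swap hmeas.aemeasurable]
        simp
    _ ≤ _ := lintegral_mono hθ

theorem lintegral_ofReal_surplus_le {ν : Measure ℝ} [IsFiniteMeasure ν] {t h W : ℝ}
    (hW : ∀ p, (p - t) * ν.real (Ici p) ≤ W) {q u : ℝ → ℝ} (hqm : Measurable q)
    (hq₀ : ∀ y, h ≤ y → 0 ≤ q y) (hq₁ : ∀ y, h ≤ y → q y ≤ 1)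
    (hsub : ∀ y ∈ Ici h, ∀ z ∈ Ici h, q y * (z - y) ≤ u z - u y) :
    ∫⁻ x in Ici h, ENNReal.ofReal ((x - t) * q x - (u x - u h)) ∂ν ≤ ENNReal.ofReal W := by
  set a := max h t
  have hha : h ≤ a := le_max_left h t
  have hta : t ≤ a := le_max_right h t
  have humono : ∀ y, h ≤ y → ∀ z, y ≤ z → u y ≤ u z := fun y hy z hyz => by
    have := hsub y hy z (hy.trans hyz)
    nlinarith [hq₀ y hy]
  have hθm : Measurable (thresholdSurplus q a t) := (thresholdSurplus_mono q a t).measurable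
  set g : ℝ → ℝ → ENNReal := fun x r =>
    {z : ℝ × ℝ | a ≤ z.1 ∧ z.2 < q z.1}.indicator (fun z => thresholdSurplus q a t z.2) (x, r)
  have hset : MeasurableSet {z : ℝ × ℝ | a ≤ z.1 ∧ z.2 < q z.1} :=
    (measurableSet_le measurable_const measurable_fst).inter
      (measurableSet_lt measurable_snd (hqm.comp measurable_fst))
  have hgm : Measurable (Function.uncurry g) := (hθm.comp measurable_snd).indicator hset
  have hpt : ∀ x ∈ Ici h, ENNReal.ofReal ((x - t) * q x - (u x - u h)) ≤
      ∫⁻ r in Ico (0 : ℝ) 1, g x r := by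
    intro x hx
    rcases le_or_gt a x with hax | hxa
    · have h1 := ofReal_surplus_le_lintegral_thresholdSurplus hta hax hqm
        (fun y hy => hq₀ y (hha.trans hy))
        (fun y hy z hz => hsub y (hha.trans hy) z (hha.trans hz))
      calc _ ≤ ENNReal.ofReal ((x - t) * q x - (u x - u a)) :=
            ENNReal.ofReal_le_ofReal (by linarith [humono h le_rfl a hha])
        _ ≤ _ := h1
        _ = ∫⁻ r in Ico 0 (q x), g x r := by
            refine setLIntegral_congr_fun measurableSet_Ico fun r hr => ?_
            simp [g, indicator, hax, hr.2]
        _ ≤ _ := lintegral_mono_set (Ico_subset_Ico_right (hq₁ x hx))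
    · have hxt : x < t := by
        rcases lt_max_iff.1 hxa with h' | h'
        · exact absurd h' (not_lt.2 hx)
        · exact h'
      refine (ENNReal.ofReal_of_nonpos ?_).trans_le bot_le
      nlinarith [hq₀ x hx, humono h le_rfl x hx]
  calc _ ≤ ∫⁻ x in Ici h, (∫⁻ r in Ico (0 : ℝ) 1, g x r) ∂ν := setLIntegral_mono' measurableSet_Ici hpt
    _ ≤ ∫⁻ x, (∫⁻ r in Ico (0 : ℝ) 1, g x r) ∂ν := setLIntegral_le_lintegral _ _
    _ = ∫⁻ r in Ico (0 : ℝ) 1, ∫⁻ x, g x r ∂ν := lintegral_lintegral_swap hgm.aemeasurable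
    _ ≤ ∫⁻ r in Ico (0 : ℝ) 1, ENNReal.ofReal W := by
        refine lintegral_mono fun r => ?_
        have h1 : ∀ x, g x r =
            {x | a ≤ x ∧ r < q x}.indicator (fun _ => thresholdSurplus q a t r) x := fun x => by
          simp [g, indicator]
        have h2 : MeasurableSet {x | a ≤ x ∧ r < q x} :=
          (measurableSet_le measurable_const measurable_id).inter
            (measurableSet_lt measurable_const hqm)
        simp only [h1]
        rw [lintegral_indicator_const h2]
        exact thresholdSurplus_mul_measure_le hta hW q r
    _ = ENNReal.ofReal W := by simp

section Selection

variable {m : ℕ} {L : Set (Lottery m)} {s : (Fin m → ℝ) → Option (Lottery m)}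

/-- The utility of a possibly-absent lottery. -/
def selUtil (o : Option (Lottery m)) (v : Fin m → ℝ) : ℝ :=
  ∑ j, selQ o j * v j - selP o

theorem selQ_nonneg (o : Option (Lottery m)) (j : Fin m) : 0 ≤ selQ o j := by
  cases o with
  | none => exact le_rfl
  | some ℓ => exact ℓ.q_nonneg j

theorem sum_selQ_le_one (o : Option (Lottery m)) : ∑ j, selQ o j ≤ 1 := by
  cases o with
  | none => simp [selQ]
  | some ℓ => exact ℓ.q_sum_le_one

theorem selQ_le_one (o : Option (Lottery m)) (j : Fin m) : selQ o j ≤ 1 :=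
  (Finset.single_le_sum (fun k _ => selQ_nonneg o k) (Finset.mem_univ j)).trans
    (sum_selQ_le_one o)

theorem selP_nonneg (o : Option (Lottery m)) : 0 ≤ selP o := by
  cases o with
  | none => exact le_rfl
  | some ℓ => exact ℓ.p_nonneg

theorem IsSelection.selUtil_nonneg (hs : IsSelection L s) {v : Fin m → ℝ} (hv : ∀ j, 0 ≤ v j) :
    0 ≤ selUtil (s v) v := by
  cases h : s v with
  | none => simp [selUtil, selQ, selP]
  | some ℓ => exact (hs.buy_opt v hv ℓ h).2.1

theorem IsSelection.selUtil_le (hs : IsSelection L s) {v w : Fin m → ℝ} (hv : ∀ j, 0 ≤ v j)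
    (hw : ∀ j, 0 ≤ w j) : selUtil (s v) w ≤ selUtil (s w) w := by
  cases h : s v with
  | none => simpa [selUtil, selQ, selP] using hs.selUtil_nonneg hw
  | some ℓ =>
    have hℓ := (hs.buy_opt v hv ℓ h).1
    cases h' : s w with
    | none => simpa [selUtil, selQ, selP, Lottery.util] using hs.no_buy w hw h' ℓ hℓ
    | some ℓ' => exact (hs.buy_opt w hw ℓ' h').2.2 ℓ hℓ

theorem IsSelection.measurable_selUtil (hs : IsSelection L s) :
    Measurable fun v => selUtil (s v) v :=
  (Finset.measurable_sum _ fun j _ => (hs.measQ j).mul (measurable_pi_apply j)).sub hs.measP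

theorem selUtil_update_sub (o : Option (Lottery m)) (v : Fin m → ℝ) (j : Fin m) (y z : ℝ) :
    selUtil o (Function.update v j z) - selUtil o (Function.update v j y) =
      selQ o j * (z - y) := by
  simp only [selUtil, sub_sub_sub_cancel_right, ← Finset.sum_sub_distrib, ← mul_sub]
  rw [Finset.sum_eq_single j]
  · simp
  · intro k _ hk
    simp [Function.update_of_ne hk]
  · simp

theorem IsSelection.selQ_mul_sub_le (hs : IsSelection L s) (v : Fin m → ℝ) (j : Fin m) {y z : ℝ}
    (hy : ∀ k, 0 ≤ Function.update v j y k) (hz : ∀ k, 0 ≤ Function.update v j z k) :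
    selQ (s (Function.update v j y)) j * (z - y) ≤
      selUtil (s (Function.update v j z)) (Function.update v j z) -
        selUtil (s (Function.update v j y)) (Function.update v j y) := by
  rw [← selUtil_update_sub (s (Function.update v j y)) v j y z]
  linarith [hs.selUtil_le hy hz]

/-- The largest value (in absolute terms) among the items other than `j`. -/
noncomputable def otherMax (j : Fin m) (v : Fin m → ℝ) : ℝ :=
  ‖Function.update v j 0‖

theorem otherMax_nonneg (j : Fin m) (v : Fin m → ℝ) : 0 ≤ otherMax j v := norm_nonneg _

theorem otherMax_update (j : Fin m) (v : Fin m → ℝ) (x : ℝ) :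
    otherMax j (Function.update v j x) = otherMax j v := by
  simp [otherMax]

theorem measurable_otherMax (j : Fin m) : Measurable (otherMax (m := m) j) :=
  (measurable_pi_lambda _ fun k => by
    rcases eq_or_ne k j with rfl | hk
    · simp
    · simpa [Function.update_of_ne hk] using measurable_pi_apply k).norm

theorem le_otherMax {j k : Fin m} (hk : k ≠ j) (v : Fin m → ℝ) : v k ≤ otherMax j v := by
  have h := norm_le_pi_norm (Function.update v j 0) k
  rw [Function.update_of_ne hk] at h
  exact (le_abs_self _).trans h

theorem otherMax_le {j : Fin m} {v : Fin m → ℝ} (hv : ∀ k, 0 ≤ v k) (hj : ∀ k, v k ≤ v j) :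
    otherMax j v ≤ v j := by
  refine (pi_norm_le_iff_of_nonneg (hv j)).2 fun k => ?_
  rcases eq_or_ne k j with rfl | hk
  · simpa using hv k
  · rw [Function.update_of_ne hk, Real.norm_eq_abs, abs_of_nonneg (hv k)]
    exact hj k

/-- The surplus over `t` of the price that the single-item mechanism induced by `s` on item `j`
charges above the threshold `otherMax j v`. -/
noncomputable def excessPrice (s : (Fin m → ℝ) → Option (Lottery m)) (t : ℝ) (j : Fin m)
    (v : Fin m → ℝ) : ℝ :=
  (v j - t) * selQ (s v) j - (selUtil (s v) v -
    selUtil (s (Function.update v j (otherMax j v))) (Function.update v j (otherMax j v)))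

/-- Nonnegative valuations under which item `j` has value at least `otherMax j v`. -/
def favoriteSet (j : Fin m) : Set (Fin m → ℝ) :=
  {v | (∀ k, 0 ≤ v k) ∧ otherMax j v ≤ v j}

theorem measurableSet_favoriteSet (j : Fin m) : MeasurableSet (favoriteSet j) :=
  (measurableSet_le (f := fun _ : Fin m → ℝ => (0 : Fin m → ℝ)) measurable_const
    measurable_id).inter (measurableSet_le (measurable_otherMax j) (measurable_pi_apply j))

theorem IsSelection.measurable_excessPrice (hs : IsSelection L s) (t : ℝ) (j : Fin m) :
    Measurable (excessPrice s t j) := by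
  have hupd : Measurable fun v : Fin m → ℝ => Function.update v j (otherMax j v) :=
    measurable_pi_lambda _ fun k => by
      rcases eq_or_ne k j with rfl | hk
      · simpa using measurable_otherMax k
      · simpa [Function.update_of_ne hk] using measurable_pi_apply k
  exact (((measurable_pi_apply j).sub_const t).mul (hs.measQ j)).sub
    (hs.measurable_selUtil.sub (hs.measurable_selUtil.comp hupd))

theorem IsSelection.selP_le (hs : IsSelection L s) (t : ℝ) {j : Fin m} {v : Fin m → ℝ}
    (hv : ∀ k, 0 ≤ v k) :
    selP (s v) ≤ t + max (excessPrice s t j v) 0 + max (otherMax j v - t) 0 := by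
  set h := otherMax j v
  have hu : 0 ≤ selUtil (s (Function.update v j h)) (Function.update v j h) := by
    refine hs.selUtil_nonneg fun k => ?_
    rcases eq_or_ne k j with rfl | hk
    · simpa using otherMax_nonneg k v
    · simpa [Function.update_of_ne hk] using hv k
  have hsum : ∑ k, selQ (s v) k * v k ≤ selQ (s v) j * v j + (1 - selQ (s v) j) * h := by
    have h1 := sum_selQ_le_one (s v)
    rw [← Finset.add_sum_erase _ _ (Finset.mem_univ j)] at h1 ⊢
    have h2 : ∑ k ∈ Finset.univ.erase j, selQ (s v) k * v k ≤
        (∑ k ∈ Finset.univ.erase j, selQ (s v) k) * h := by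
      rw [Finset.sum_mul]
      exact Finset.sum_le_sum fun k hk => mul_le_mul_of_nonneg_left
        (le_otherMax (Finset.ne_of_mem_erase hk) v) (selQ_nonneg _ _)
    have h3 : 0 ≤ h := otherMax_nonneg j v
    nlinarith
  have hp : selP (s v) = ∑ k, selQ (s v) k * v k - selUtil (s v) v := by simp [selUtil]
  have hφ : excessPrice s t j v = (v j - t) * selQ (s v) j - (selUtil (s v) v -
    selUtil (s (Function.update v j h)) (Function.update v j h)) := rfl
  have h4 : (1 - selQ (s v) j) * (h - t) ≤ max (h - t) 0 := by
    have := le_max_left (h - t) 0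
    have := le_max_right (h - t) 0
    nlinarith [selQ_nonneg (s v) j, selQ_le_one (s v) j]
  linarith [le_max_left (excessPrice s t j v) 0]

variable {F : Fin m → Measure ℝ} [∀ j, IsProbabilityMeasure (F j)]

theorem lintegral_favoriteSet_le {j : Fin m} {f : (Fin m → ℝ) → ENNReal} (hf : Measurable f)
    {C : ENNReal}
    (hC : ∀ v : Fin m → ℝ, (∀ k, k ≠ j → 0 ≤ v k) →
      ∫⁻ x in Ici (otherMax j v), f (Function.update v j x) ∂F j ≤ C) :
    ∫⁻ v in favoriteSet j, f v ∂Measure.pi F ≤ C := by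
  rw [← lintegral_indicator (measurableSet_favoriteSet j)]
  calc _ ≤ ∫⁻ _, C ∂Measure.pi F := by
        refine lintegral_le_of_lmarginal_le {j} (hf.indicator (measurableSet_favoriteSet j))
          measurable_const fun v => ?_
        rw [lmarginal_singleton, lmarginal_singleton, lintegral_const, measure_univ, mul_one]
        by_cases hv : ∀ k, k ≠ j → 0 ≤ v k
        · refine le_trans ?_ (hC v hv)
          rw [← lintegral_indicator measurableSet_Ici]
          refine lintegral_mono fun x => indicator_apply_le' (fun hx => ?_) fun _ => bot_le
          have hx' : x ∈ Ici (otherMax j v) := by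
            simpa [otherMax_update] using hx.2
          rw [indicator_of_mem hx']
        · push Not at hv
          obtain ⟨k, hkj, hk⟩ := hv
          have hnot : ∀ x, Function.update v j x ∉ favoriteSet j := fun x hx =>
            absurd (hx.1 k) (by simpa [Function.update_of_ne hkj] using hk)
          simp [hnot]
    _ = C := by simp

theorem IsSelection.lintegral_selP_le (hs : IsSelection L s) {t : ℝ} (ht : 0 ≤ t)
    (h₀ : ∀ j, F j (Iio 0) = 0) {W : Fin m → ℝ}
    (hW : ∀ j p, (p - t) * (F j).real (Ici p) ≤ W j) :
    ∫⁻ v, ENNReal.ofReal (selP (s v)) ∂Measure.pi F ≤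
      ENNReal.ofReal (t + 2 * ∑ j, W j) := by
  have hW₀ : ∀ j, 0 ≤ W j := fun j => by simpa using hW j t
  have hae : ∀ᵐ v ∂Measure.pi F, ∀ k, 0 ≤ v k := by
    refine ae_all_iff.2 fun k => ?_
    refine (Measure.tendsto_eval_ae_ae (μ := F) (i := k)).eventually ?_
    exact measure_mono_null (fun x hx => by simpa using hx) (h₀ k)
  set f : Fin m → (Fin m → ℝ) → ENNReal := fun j v =>
    ENNReal.ofReal (excessPrice s t j v)
  set g : Fin m → (Fin m → ℝ) → ENNReal := fun j v =>
    ENNReal.ofReal (otherMax j v - t)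
  have hfm : ∀ j, Measurable (f j) := fun j => (hs.measurable_excessPrice t j).ennreal_ofReal
  have hgm : ∀ j, Measurable (g j) := fun j =>
    ((measurable_otherMax j).sub_const t).ennreal_ofReal
  have hf : ∀ j, ∫⁻ v in favoriteSet j, f j v ∂Measure.pi F ≤ ENNReal.ofReal (W j) := by
    refine fun j => lintegral_favoriteSet_le (hfm j) fun v hv => ?_
    have hnn : ∀ y, otherMax j v ≤ y → ∀ k, 0 ≤ Function.update v j y k := by
      intro y hy k
      rcases eq_or_ne k j with rfl | hk
      · simpa using (otherMax_nonneg k v).trans hy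
      · simpa [Function.update_of_ne hk] using hv k hk
    have h := lintegral_ofReal_surplus_le (ν := F j) (h := otherMax j v) (hW j)
      (q := fun x => selQ (s (Function.update v j x)) j)
      (u := fun x => selUtil (s (Function.update v j x)) (Function.update v j x))
      ((hs.measQ j).comp (measurable_update v)) (fun _ _ => selQ_nonneg _ _)
      (fun _ _ => selQ_le_one _ _)
      (fun y hy z hz => hs.selQ_mul_sub_le v j (hnn y hy) (hnn z hz))
    simpa [f, excessPrice, otherMax_update] using h
  have hg : ∀ j, ∫⁻ v in favoriteSet j, g j v ∂Measure.pi F ≤ ENNReal.ofReal (W j) := by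
    refine fun j => lintegral_favoriteSet_le (hgm j) fun v hv => ?_
    simp only [g, otherMax_update, lintegral_const, Measure.restrict_apply_univ]
    rcases le_total (otherMax j v - t) 0 with h | h
    · simp [ENNReal.ofReal_of_nonpos h]
    · rw [← ofReal_measureReal, ← ENNReal.ofReal_mul h]
      exact ENNReal.ofReal_le_ofReal (hW j _)
  have hpt : ∀ᵐ v ∂Measure.pi F, ENNReal.ofReal (selP (s v)) ≤
      ENNReal.ofReal t + ∑ j, ((favoriteSet j).indicator (f j) v +
        (favoriteSet j).indicator (g j) v) := by
    filter_upwards [hae] with v hv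
    rcases isEmpty_or_nonempty (Fin m) with hm | hm
    · have h1 := hs.selUtil_nonneg hv
      simp only [selUtil, Finset.univ_eq_empty, Finset.sum_empty] at h1
      simp [ENNReal.ofReal_of_nonpos (show selP (s v) ≤ 0 by linarith)]
    · obtain ⟨j, hj⟩ := Finite.exists_max v
      have hmem : v ∈ favoriteSet j := ⟨hv, otherMax_le hv hj⟩
      calc ENNReal.ofReal (selP (s v)) ≤ ENNReal.ofReal
            (t + max (excessPrice s t j v) 0 + max (otherMax j v - t) 0) :=
            ENNReal.ofReal_le_ofReal (hs.selP_le t hv)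
        _ ≤ ENNReal.ofReal t + (f j v + g j v) := by
            rw [ENNReal.ofReal_add (by positivity) (by positivity),
              ENNReal.ofReal_add (by positivity) (by positivity), add_assoc]
            simp [f, g]
        _ = ENNReal.ofReal t + ((favoriteSet j).indicator (f j) v +
            (favoriteSet j).indicator (g j) v) := by
            rw [indicator_of_mem hmem, indicator_of_mem hmem]
        _ ≤ _ := by
            gcongr
            exact Finset.single_le_sum (f := fun j => (favoriteSet j).indicator (f j) v +
              (favoriteSet j).indicator (g j) v) (fun _ _ => bot_le) (Finset.mem_univ j)
  have hfi : ∀ j, Measurable ((favoriteSet j).indicator (f j)) := fun j =>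
    (hfm j).indicator (measurableSet_favoriteSet j)
  have hgi : ∀ j, Measurable ((favoriteSet j).indicator (g j)) := fun j =>
    (hgm j).indicator (measurableSet_favoriteSet j)
  calc _ ≤ ∫⁻ v, (ENNReal.ofReal t + ∑ j, ((favoriteSet j).indicator (f j) v +
        (favoriteSet j).indicator (g j) v)) ∂Measure.pi F := lintegral_mono_ae hpt
    _ = ENNReal.ofReal t + ∑ j, (∫⁻ v in favoriteSet j, f j v ∂Measure.pi F +
        ∫⁻ v in favoriteSet j, g j v ∂Measure.pi F) := by
        rw [lintegral_add_left measurable_const,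
          lintegral_finsetSum]
        swap
        · exact fun j _ => (hfi j).add (hgi j)
        simp only [lintegral_const, measure_univ, mul_one]
        congr 1
        refine Finset.sum_congr rfl fun j _ => ?_
        rw [lintegral_add_left (hfi j), lintegral_indicator (measurableSet_favoriteSet j),
          lintegral_indicator (measurableSet_favoriteSet j)]
    _ ≤ ENNReal.ofReal t + ∑ j, ENNReal.ofReal (W j + W j) := by
        gcongr with j
        rw [ENNReal.ofReal_add (hW₀ j) (hW₀ j)]
        exact add_le_add (hf j) (hg j)
    _ = _ := by
        rw [← ENNReal.ofReal_sum_of_nonneg fun j _ => add_nonneg (hW₀ j) (hW₀ j),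
          ← ENNReal.ofReal_add ht (Finset.sum_nonneg fun j _ => add_nonneg (hW₀ j) (hW₀ j)),
          Finset.sum_add_distrib, two_mul]

theorem IsSelection.lotteryRevenue_le (hs : IsSelection L s) {t : ℝ} (ht : 0 ≤ t)
    (h₀ : ∀ j, F j (Iio 0) = 0) {W : Fin m → ℝ}
    (hW : ∀ j p, (p - t) * (F j).real (Ici p) ≤ W j) :
    lotteryRevenue (Measure.pi F) s ≤ t + 2 * ∑ j, W j := by
  have hW₀ : ∀ j, 0 ≤ W j := fun j => by simpa using hW j t
  rw [lotteryRevenue, integral_eq_lintegral_of_nonneg_ae (ae_of_all _ fun v => selP_nonneg _)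
    hs.measP.aestronglyMeasurable]
  refine ENNReal.toReal_le_of_le_ofReal ?_ (hs.lintegral_selP_le ht h₀ hW)
  have := Finset.sum_nonneg fun j (_ : j ∈ Finset.univ) => hW₀ j
  positivity

end Selection

section ItemPricing

variable {m : ℕ}

/-- The lottery that offers item `j` at the deterministic price `c`. -/
def itemLottery (j : Fin m) {c : ℝ} (hc : 0 ≤ c) : Lottery m where
  q := fun k => if k = j then 1 else 0
  p := c
  q_nonneg := fun k => by split_ifs <;> norm_num
  q_sum_le_one := by simp
  p_nonneg := hc

theorem itemLottery_util (j : Fin m) {c : ℝ} (hc : 0 ≤ c) (v : Fin m → ℝ) :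
    (itemLottery j hc).util v = v j - c := by
  simp [itemLottery, Lottery.util]

theorem exists_itemPricing_selection (p : Fin m → ℝ) (hp : ∀ j, 0 ≤ p j) :
    ∃ s, IsSelection (range fun j => itemLottery j (hp j)) s ∧
      (∀ v, (∃ j, p j ≤ v j) → ∃ j, p j ≤ v j ∧ s v = some (itemLottery j (hp j))) ∧
      ∀ v, s v = none ∨ ∃ j, s v = some (itemLottery j (hp j)) := by
  classical
  set best : (Fin m → ℝ) → Fin m → Prop := fun v j =>
    p j ≤ v j ∧ ∀ k, v k - p k ≤ v j - p j
  have hbm : Measurable best := measurable_pi_lambda _ fun j =>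
    (measurableSet_setOfPred.1 <| (measurableSet_le measurable_const (measurable_pi_apply j)).inter
      (measurableSet_le (f := fun v : Fin m → ℝ => fun k => v k - p k)
        (g := fun v _ => v j - p j) (by fun_prop) (by fun_prop)))
  set choice : (Fin m → Prop) → Option (Lottery m) := fun P =>
    if h : ∃ j, P j then some (itemLottery h.choose (hp _)) else none
  have hpos : ∀ v, (∃ j, best v j) →
      ∃ j, best v j ∧ choice (best v) = some (itemLottery j (hp j)) := fun v h =>
    ⟨h.choose, h.choose_spec, dif_pos h⟩
  have hneg : ∀ v, (¬ ∃ j, best v j) → choice (best v) = none := fun v h => dif_neg h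
  have hex : ∀ v, (∃ j, p j ≤ v j) → ∃ j, best v j := by
    rintro v ⟨i, hi⟩
    have : Nonempty (Fin m) := ⟨i⟩
    obtain ⟨j, hj⟩ := Finite.exists_max fun k => v k - p k
    exact ⟨j, by linarith [hj i], hj⟩
  refine ⟨fun v => choice (best v), ⟨fun j => ?_, ?_, fun v _ ℓ hℓ => ?_, fun v _ hnone ℓ hℓ => ?_⟩,
    fun v h => ?_, fun v => ?_⟩
  · exact (Measurable.of_discrete (f := fun P => selQ (choice P) j)).comp hbm
  · exact (Measurable.of_discrete (f := fun P => selP (choice P))).comp hbm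
  · by_cases h : ∃ j, best v j
    · obtain ⟨j, hj, hjs⟩ := hpos v h
      obtain rfl : itemLottery j (hp j) = ℓ := Option.some_injective _ (hjs.symm.trans hℓ)
      refine ⟨⟨j, rfl⟩, ?_, ?_⟩
      · rw [itemLottery_util]
        linarith [hj.1]
      · rintro _ ⟨k, rfl⟩
        simpa only [itemLottery_util] using hj.2 k
    · simp [hneg v h] at hℓ
  · obtain ⟨j, rfl⟩ := hℓ
    rw [itemLottery_util]
    by_contra! hlt
    obtain ⟨k, -, hk⟩ := hpos v (hex v ⟨j, by linarith⟩)
    simp [hk] at hnone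
  · obtain ⟨j, hj, hjs⟩ := hpos v (hex v h)
    exact ⟨j, hj.1, hjs⟩
  · by_cases h : ∃ j, best v j
    · obtain ⟨j, -, hjs⟩ := hpos v h
      exact Or.inr ⟨j, hjs⟩
    · exact Or.inl (hneg v h)

/-- The valuations at which only item `j` is worth its price. -/
def onlyAffordable (p : Fin m → ℝ) (j : Fin m) : Set (Fin m → ℝ) :=
  univ.pi (Function.update (fun k => Iio (p k)) j (Ici (p j)))

theorem le_of_mem_onlyAffordable {p v : Fin m → ℝ} {j : Fin m} (hv : v ∈ onlyAffordable p j) :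
    p j ≤ v j := by
  simpa using hv j (mem_univ j)

theorem lt_of_mem_onlyAffordable {p v : Fin m → ℝ} {j k : Fin m} (hv : v ∈ onlyAffordable p j)
    (hk : k ≠ j) : v k < p k := by
  simpa [Function.update_of_ne hk] using hv k (mem_univ k)

theorem measurableSet_onlyAffordable (p : Fin m → ℝ) (j : Fin m) :
    MeasurableSet (onlyAffordable p j) := by
  refine MeasurableSet.univ_pi fun k => ?_
  rcases eq_or_ne k j with rfl | hk
  · simp
  · simp [Function.update_of_ne hk]

variable (F : Fin m → Measure ℝ) [∀ j, IsProbabilityMeasure (F j)]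

theorem le_measureReal_onlyAffordable (p : Fin m → ℝ) (j : Fin m) :
    (F j).real (Ici (p j)) * ∏ k, (F k).real (Iio (p k)) ≤
      (Measure.pi F).real (onlyAffordable p j) := by
  rw [measureReal_def (Measure.pi F), onlyAffordable, Measure.pi_pi, ENNReal.toReal_prod,
    ← Finset.mul_prod_erase _ _ (Finset.mem_univ j),
    ← Finset.mul_prod_erase (a := j) _ (fun k => (F k _).toReal) (Finset.mem_univ j)]
  have hcongr : ∏ k ∈ Finset.univ.erase j,
      (F k (Function.update (fun k => Iio (p k)) j (Ici (p j)) k)).toReal =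
      ∏ k ∈ Finset.univ.erase j, (F k).real (Iio (p k)) :=
    Finset.prod_congr rfl fun k hk => by
      rw [Function.update_of_ne (Finset.ne_of_mem_erase hk), measureReal_def]
  rw [hcongr, Function.update_self, ← measureReal_def]
  have hprod : 0 ≤ ∏ k ∈ Finset.univ.erase j, (F k).real (Iio (p k)) :=
    Finset.prod_nonneg fun _ _ => measureReal_nonneg
  exact mul_le_mul_of_nonneg_left (mul_le_of_le_one_left hprod measureReal_le_one)
    measureReal_nonneg

/-- A price vector above `t` earns `t` whenever some item is affordable, and the surplus
`p j - t` at least whenever only item `j` is. -/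
theorem exists_itemPricing_revenue_ge {t : ℝ} (ht : 0 ≤ t) (p : Fin m → ℝ) (hp : ∀ j, t ≤ p j)
    (hm : 0 < m) :
    ∃ (L : Set (Lottery m)) (s : (Fin m → ℝ) → Option (Lottery m)),
      L.Nonempty ∧ IsItemPricing L ∧ IsSelection L s ∧
      t * (1 - ∏ k, (F k).real (Iio (p k))) +
        (∑ j, (p j - t) * (F j).real (Ici (p j))) * ∏ k, (F k).real (Iio (p k)) ≤
        lotteryRevenue (Measure.pi F) s := by
  obtain ⟨s, hs, hbuy, hran⟩ := exists_itemPricing_selection p fun j => ht.trans (hp j)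
  refine ⟨_, s, ⟨_, mem_range_self ⟨0, hm⟩⟩, ?_, hs, ?_⟩
  · rintro _ ⟨j, rfl⟩
    exact ⟨j, rfl⟩
  set A : Set (Fin m → ℝ) := univ.pi fun k => Iio (p k)
  have hA : MeasurableSet A := MeasurableSet.univ_pi fun k => measurableSet_Iio
  have hE := measurableSet_onlyAffordable p
  have hAreal : (Measure.pi F).real Aᶜ = 1 - ∏ k, (F k).real (Iio (p k)) := by
    rw [probReal_compl_eq_one_sub hA, measureReal_def, Measure.pi_pi, ENNReal.toReal_prod]
    rfl
  have hpt : ∀ v, Aᶜ.indicator (fun _ => t) v +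
      ∑ j, (onlyAffordable p j).indicator (fun _ => p j - t) v ≤ selP (s v) := by
    intro v
    by_cases hv : v ∈ A
    · have hnot : ∀ j, v ∉ onlyAffordable p j := fun j hj =>
        absurd (hv j (mem_univ j)) (not_lt.2 (le_of_mem_onlyAffordable hj))
      simp [hv, hnot, selP_nonneg]
    · have hv' : ∃ j, p j ≤ v j := by
        by_contra! hlt
        exact hv fun j _ => hlt j
      obtain ⟨i, hi, hsi⟩ := hbuy v hv'
      have hsum : ∑ j, (onlyAffordable p j).indicator (fun _ => p j - t) v =
          (onlyAffordable p i).indicator (fun _ => p i - t) v := by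
        refine Finset.sum_eq_single i (fun j _ hj => indicator_of_notMem (fun hmem => ?_) _)
          (by simp)
        exact absurd hi (not_le.2 (lt_of_mem_onlyAffordable hmem hj.symm))
      have hle : (onlyAffordable p i).indicator (fun _ => p i - t) v ≤ p i - t :=
        indicator_apply_le' (fun _ => le_rfl) fun _ => sub_nonneg.2 (hp i)
      rw [hsum, indicator_of_mem (show v ∈ Aᶜ from hv), hsi]
      change _ ≤ p i
      linarith
  have hbound : ∀ v, ‖selP (s v)‖ ≤ ∑ j, p j := by
    intro v
    have hp₀ : ∀ j, 0 ≤ p j := fun j => ht.trans (hp j)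
    rw [Real.norm_eq_abs, abs_of_nonneg (selP_nonneg _)]
    rcases hran v with h | ⟨j, h⟩
    · rw [h]
      exact Finset.sum_nonneg fun j _ => hp₀ j
    · rw [h]
      exact Finset.single_le_sum (f := p) (fun j _ => hp₀ j) (Finset.mem_univ j)
  have hint : Integrable (fun v => selP (s v)) (Measure.pi F) :=
    Integrable.of_bound hs.measP.aestronglyMeasurable _ (ae_of_all _ hbound)
  have hintA : Integrable (Aᶜ.indicator fun _ => t) (Measure.pi F) :=
    (integrable_const t).indicator hA.compl
  have hintE : ∀ j, Integrable ((onlyAffordable p j).indicator fun _ => p j - t)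
      (Measure.pi F) := fun j => (integrable_const _).indicator (hE j)
  have hintS : Integrable (fun v => ∑ j, (onlyAffordable p j).indicator (fun _ => p j - t) v)
      (Measure.pi F) := integrable_finsetSum _ fun j _ => hintE j
  calc _ ≤ (Measure.pi F).real Aᶜ * t +
        ∑ j, (Measure.pi F).real (onlyAffordable p j) * (p j - t) := by
        rw [hAreal, mul_comm t, Finset.sum_mul]
        refine add_le_add le_rfl (Finset.sum_le_sum fun j _ => ?_)
        have h := mul_le_mul_of_nonneg_left (le_measureReal_onlyAffordable F p j)
          (sub_nonneg.2 (hp j))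
        linarith
    _ = ∫ v, (Aᶜ.indicator (fun _ => t) v +
        ∑ j, (onlyAffordable p j).indicator (fun _ => p j - t) v) ∂Measure.pi F := by
        rw [integral_add hintA hintS, integral_finsetSum _ fun j _ => hintE j,
          integral_indicator_const _ hA.compl]
        simp_rw [integral_indicator_const _ (hE _), smul_eq_mul]
    _ ≤ _ := integral_mono (hintA.add hintS) hint hpt

end ItemPricing

end

/-- For a single unit-demand buyer with independent item
values `v j ∼ F j` (Borel distributions on `ℝ≥0` with finite mean), the optimal
item-pricing revenue is at least one fourth of the optimal lottery revenue. -/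
theorem optItemPricing_ge_quarter_optLottery
    {m : ℕ} (F : Fin m → Measure ℝ) [∀ j, IsProbabilityMeasure (F j)]
    (hF_nonneg : ∀ j, F j (Set.Iio 0) = 0)
    (hF_mean : ∀ j, Integrable id (F j)) :
    (1 / 4) * optLotteryRev (Measure.pi F) ≤ optItemPricingRev (Measure.pi F) := by
  obtain ⟨t, ht, hsum⟩ := exists_sum_postedSurplus_eq F hF_nonneg hF_mean
  have hub : ∀ (L : Set (Lottery m)) s, IsSelection L s →
      lotteryRevenue (Measure.pi F) s ≤ 3 * t := fun L s hs => by
    have h := hs.lotteryRevenue_le ht hF_nonneg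
      fun j p => le_postedSurplus (hF_nonneg j) (hF_mean j) t p
    rw [hsum] at h
    linarith
  have hlottery : optLotteryRev (Measure.pi F) ≤ 3 * t := by
    refine Real.sSup_le ?_ (by positivity)
    rintro _ ⟨L, s, -, hs, rfl⟩
    exact hub L s hs
  have hitem : t ≤ optItemPricingRev (Measure.pi F) := by
    rcases Nat.eq_zero_or_pos m with rfl | hm
    · rw [← hsum]
      refine (Finset.sum_of_isEmpty _).trans_le (Real.sSup_nonneg ?_)
      rintro _ ⟨L, s, -, -, -, rfl⟩
      exact integral_nonneg fun v => selP_nonneg _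
    · refine le_of_forall_pos_le_add fun ε hε => ?_
      have hm' : (0 : ℝ) < m := by exact_mod_cast hm
      choose p hp hpε using fun j =>
        exists_price_ge_postedSurplus_sub_le (F j) t (div_pos hε hm')
      obtain ⟨L, s, hL, hLi, hs, hrev⟩ := exists_itemPricing_revenue_ge F ht p hp hm
      have hle : lotteryRevenue (Measure.pi F) s ≤ optItemPricingRev (Measure.pi F) := by
        refine le_csSup ⟨3 * t, ?_⟩ ⟨L, s, hL, hLi, hs, rfl⟩
        rintro _ ⟨L, s, -, -, hs, rfl⟩
        exact hub L s hs
      have hsurplus : t - ε ≤ ∑ j, (p j - t) * (F j).real (Set.Ici (p j)) := by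
        refine le_trans (le_of_eq ?_) (Finset.sum_le_sum fun j _ => hpε j)
        rw [Finset.sum_sub_distrib, hsum]
        simp [field]
      have hQ₀ : 0 ≤ ∏ k, (F k).real (Set.Iio (p k)) :=
        Finset.prod_nonneg fun _ _ => measureReal_nonneg
      have hQ₁ : ∏ k, (F k).real (Set.Iio (p k)) ≤ 1 :=
        Finset.prod_le_one (fun _ _ => measureReal_nonneg) fun _ _ => measureReal_le_one
      nlinarith
  linarith
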